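/- Let n ≥ 3 and 0 < λ ≤ Λ, and set ñ = (λ/Λ)(n−1) + 1. Let p > 1 and assume either ñ > 2 and p ≤ ñ/(ñ−2), or ñ ≤ 2. If u : ℝⁿ → ℝ is continuous, nonnegative, and is a viscosity supersolution of M⁺_{λ,Λ}(D²u) + u^p = 0 in ℝⁿ, then u is identically zero. -/

import Mathlib

open scoped BigOperators

/-- The Pucci maximal operator `M⁺_{λ,Λ}`: for a symmetric matrix it equals
`Λ · (sum of positive eigenvalues) + λ · (sum of negative eigenvalues)`. -/
noncomputable def pucciMax (lam Lam : ℝ) {n : ℕ} (M : Matrix (Fin n) (Fin n) ℝ) : ℝ :=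
  if h : M.IsHermitian then
    ∑ i, (Lam * max (h.eigenvalues i) 0 + lam * min (h.eigenvalues i) 0)
  else 0

/-- The Hessian matrix of `φ` at `x`. -/
noncomputable def hess {n : ℕ} (φ : EuclideanSpace ℝ (Fin n) → ℝ)
    (x : EuclideanSpace ℝ (Fin n)) : Matrix (Fin n) (Fin n) ℝ :=
  fun i j => iteratedFDeriv ℝ 2 φ x ![EuclideanSpace.single i 1, EuclideanSpace.single j 1]

/-- `u` is a viscosity supersolution of `M⁺_{λ,Λ}(D²u) + g = 0` in `Ω`. -/
def PucciSupersol (lam Lam : ℝ) {n : ℕ} (Ω : Set (EuclideanSpace ℝ (Fin n)))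
    (u g : EuclideanSpace ℝ (Fin n) → ℝ) : Prop :=
  ∀ x₀ ∈ Ω, ∀ φ : EuclideanSpace ℝ (Fin n) → ℝ, ContDiff ℝ 2 φ →
    IsLocalMin (fun x => u x - φ x) x₀ → pucciMax lam Lam (hess φ x₀) + g x₀ ≤ 0

/-- Testing the eigenvalue sum of the Pucci operator against the constant coefficient matrix
`lam • 1 + (Lam - lam) • e eᵀ`. -/
lemma pucciMax_ge {n : ℕ} {lam Lam : ℝ} (hLam : lam ≤ Lam) {M : Matrix (Fin n) (Fin n) ℝ}
    (hM : M.IsHermitian) (e : EuclideanSpace ℝ (Fin n)) (he : ‖e‖ = 1) :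
    lam * M.trace + (Lam - lam) * ∑ i, ∑ j, e i * M i j * e j ≤ pucciMax lam Lam M := by
  have hquad : ∑ i, ∑ j, e i * M i j * e j
      = ∑ i, hM.eigenvalues i * (inner ℝ e (hM.eigenvectorBasis i)) ^ 2 := by
    have h1 : ∑ i, ∑ j, e i * M i j * e j = inner ℝ e (Matrix.toEuclideanLin M e) := by
      simp only [PiLp.inner_apply, Matrix.toLpLin_apply, Matrix.mulVec, dotProduct,
        RCLike.inner_apply, conj_trivial, Finset.sum_mul]
      exact Finset.sum_congr rfl fun i _ => Finset.sum_congr rfl fun j _ => by ring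
    have hsymm := Matrix.isSymmetric_toEuclideanLin_iff.mpr hM
    rw [h1, ← hM.eigenvectorBasis.sum_inner_mul_inner]
    refine Finset.sum_congr rfl fun i _ => ?_
    have h2 : Matrix.toEuclideanLin M (hM.eigenvectorBasis i)
        = hM.eigenvalues i • hM.eigenvectorBasis i := by
      have := hM.mulVec_eigenvectorBasis i
      ext j
      simpa [Matrix.toLpLin_apply] using congrFun this j
    rw [← hsymm, h2, inner_smul_left, real_inner_comm e]
    simp only [conj_trivial]
    ring
  have htr : M.trace = ∑ i, hM.eigenvalues i := by
    simpa using hM.trace_eq_sum_eigenvalues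
  rw [hquad, htr, pucciMax, dif_pos hM, Finset.mul_sum, Finset.mul_sum, ← Finset.sum_add_distrib]
  refine Finset.sum_le_sum fun i _ => ?_
  have ht : (inner ℝ e (hM.eigenvectorBasis i)) ^ 2 ≤ 1 := by
    have := abs_real_inner_le_norm e (hM.eigenvectorBasis i)
    rw [he, hM.eigenvectorBasis.orthonormal.1 i, one_mul] at this
    exact (sq_le_one_iff_abs_le_one _).mpr this
  have ht0 := sq_nonneg (inner ℝ e (hM.eigenvectorBasis i))
  set t := (inner ℝ e (hM.eigenvectorBasis i)) ^ 2
  rcases le_total 0 (hM.eigenvalues i) with h | h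
  · rw [max_eq_left h, min_eq_right h]
    nlinarith [mul_nonneg (mul_nonneg h (sub_nonneg.mpr hLam)) (sub_nonneg.mpr ht)]
  · rw [max_eq_right h, min_eq_left h]
    nlinarith [mul_nonneg (mul_nonneg (neg_nonneg.mpr h) (sub_nonneg.mpr hLam)) ht0]

/-- The Hessian, at `x`, of a quadratic polynomial in `‖· - y‖ ^ 2`. -/
lemma hess_radial {n : ℕ} (x y : EuclideanSpace ℝ (Fin n)) (b c : ℝ) :
    hess (fun z => b * ‖z - y‖ ^ 2 + c * (‖z - y‖ ^ 2 - ‖x - y‖ ^ 2) ^ 2) x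
      = fun i j => (if i = j then 2 * b else 0) + 8 * c * ((x - y) i * (x - y) j) := by
  have hq (z : EuclideanSpace ℝ (Fin n)) :
      HasFDerivAt (fun z => ‖z - y‖ ^ 2) (2 • innerSL ℝ (z - y)) z := by
    simpa using ((hasFDerivAt_id z).sub_const y).norm_sq
  have h1 : fderiv ℝ (fun z => b * ‖z - y‖ ^ 2 + c * (‖z - y‖ ^ 2 - ‖x - y‖ ^ 2) ^ 2)
      = fun z => (2 * b + 4 * c * (‖z - y‖ ^ 2 - ‖x - y‖ ^ 2)) • innerSL ℝ (z - y) := by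
    funext z
    have h := ((hq z).const_mul b).add ((((hq z).sub_const (‖x - y‖ ^ 2)).pow 2).const_mul c)
    refine h.fderiv.trans ?_
    ext v
    simp
    ring
  have h2 : HasFDerivAt
      (fun z => (2 * b + 4 * c * (‖z - y‖ ^ 2 - ‖x - y‖ ^ 2)) • innerSL ℝ (z - y)) _ x :=
    ((((hq x).sub_const (‖x - y‖ ^ 2)).const_mul (4 * c)).const_add (2 * b)).smul
      ((innerSL ℝ).hasFDerivAt.comp x ((hasFDerivAt_id x).sub_const y))
  funext i j
  rw [hess, iteratedFDeriv_two_apply, h1, h2.fderiv]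
  have h3 : inner ℝ (EuclideanSpace.single i (1 : ℝ)) (EuclideanSpace.single j 1)
      = if i = j then (1 : ℝ) else 0 := by
    simp [EuclideanSpace.inner_single_right, eq_comm]
  change (2 * b + 4 * c * (‖x - y‖ ^ 2 - ‖x - y‖ ^ 2))
      * inner ℝ (EuclideanSpace.single i (1 : ℝ)) (EuclideanSpace.single j 1)
    + 4 * c * (2 • inner ℝ (x - y) (EuclideanSpace.single i (1 : ℝ)))
      * inner ℝ (x - y) (EuclideanSpace.single j (1 : ℝ)) = _
  rw [h3]
  simp [EuclideanSpace.inner_single_right]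
  ring

/-- The supersolution inequality of `u` at `x₀` against quadratic polynomials in `‖· - y‖ ^ 2` that
are nonincreasing at the point of contact, for the radial Laplacian in (real) dimension `N`. -/
def RadialSupersol {E : Type*} [NormedAddCommGroup E] (Lam N p : ℝ) (u : E → ℝ) (y : E) : Prop :=
  ∀ x₀ : E, ∀ b c : ℝ, b ≤ 0 →
    IsLocalMin (fun x => u x - (b * ‖x - y‖ ^ 2 + c * (‖x - y‖ ^ 2 - ‖x₀ - y‖ ^ 2) ^ 2)) x₀ →
    Lam * (2 * b * N + 8 * c * ‖x₀ - y‖ ^ 2) + u x₀ ^ p ≤ 0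

lemma exists_unit_colinear {n : ℕ} (hn : 0 < n) (z : EuclideanSpace ℝ (Fin n)) :
    ∃ e : EuclideanSpace ℝ (Fin n), ‖e‖ = 1 ∧ z = ‖z‖ • e := by
  by_cases hz : z = 0
  · exact ⟨EuclideanSpace.single ⟨0, hn⟩ 1, by simp, by simp [hz]⟩
  · have : ‖z‖ ≠ 0 := norm_ne_zero_iff.mpr hz
    exact ⟨‖z‖⁻¹ • z, by simp [norm_smul, this], by simp [smul_smul, this]⟩

lemma PucciSupersol.radialSupersol {n : ℕ} (hn : 0 < n) {lam Lam : ℝ} (hlam : 0 < lam)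
    (hLam : lam ≤ Lam) {N p : ℝ} (hN : lam / Lam * ((n : ℝ) - 1) + 1 ≤ N)
    {u : EuclideanSpace ℝ (Fin n) → ℝ}
    (hsuper : PucciSupersol lam Lam Set.univ u (fun x => u x ^ p))
    (y : EuclideanSpace ℝ (Fin n)) : RadialSupersol Lam N p u y := by
  intro x₀ b c hb hmin
  have hL : 0 < Lam := hlam.trans_le hLam
  have hsm : ContDiff ℝ 2 (fun x : EuclideanSpace ℝ (Fin n) =>
      b * ‖x - y‖ ^ 2 + c * (‖x - y‖ ^ 2 - ‖x₀ - y‖ ^ 2) ^ 2) := by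
    have hq : ContDiff ℝ 2 (fun x : EuclideanSpace ℝ (Fin n) => ‖x - y‖ ^ 2) :=
      (contDiff_id.sub contDiff_const).norm_sq ℝ
    exact (contDiff_const.mul hq).add (contDiff_const.mul ((hq.sub contDiff_const).pow 2))
  have key := hsuper x₀ (Set.mem_univ _) _ hsm hmin
  obtain ⟨e, he, hze⟩ := exists_unit_colinear hn (x₀ - y)
  rw [hess_radial] at key
  set s := ‖x₀ - y‖
  have hz (i : Fin n) : (x₀ - y) i = s * e i := by
    conv_lhs => rw [hze]
    simp
  have hee : ∑ i, e i * e i = 1 := by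
    have := EuclideanSpace.real_norm_sq_eq e
    rw [he] at this
    simpa [sq] using this.symm
  simp only [hz] at key
  set M : Matrix (Fin n) (Fin n) ℝ :=
    fun i j => (if i = j then 2 * b else 0) + 8 * c * (s * e i * (s * e j)) with hMdef
  have hM : M.IsHermitian := by
    refine Matrix.IsHermitian.ext fun i j => ?_
    simp only [hMdef, star_trivial, eq_comm (a := j)]
    ring
  have htr : M.trace = 2 * b * n + 8 * c * s ^ 2 := by
    have : M.trace = ∑ i, (2 * b + 8 * c * s ^ 2 * (e i * e i)) :=
      Finset.sum_congr rfl fun i _ => by simp [hMdef, Matrix.diag]; ring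
    rw [this, Finset.sum_add_distrib, ← Finset.mul_sum _ _ (8 * c * s ^ 2), hee]
    simp
    ring
  have hquad : ∑ i, ∑ j, e i * M i j * e j = 2 * b + 8 * c * s ^ 2 := by
    have (i : Fin n) : ∑ j, e i * M i j * e j = (2 * b + 8 * c * s ^ 2) * (e i * e i) := by
      calc ∑ j, e i * M i j * e j
          = ∑ j, ((if i = j then 2 * b * e i * e j else 0)
              + 8 * c * s ^ 2 * (e i * e i) * (e j * e j)) :=
            Finset.sum_congr rfl fun j _ => by simp only [hMdef]; split_ifs <;> ring
        _ = (2 * b + 8 * c * s ^ 2) * (e i * e i) := by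
            rw [Finset.sum_add_distrib, ← Finset.mul_sum, hee]
            simp
            ring
    rw [Finset.sum_congr rfl fun i _ => this i, ← Finset.mul_sum, hee, mul_one]
  have hp := pucciMax_ge hLam hM e he
  rw [htr, hquad] at hp
  have h1 : lam * (2 * b * n + 8 * c * s ^ 2) + (Lam - lam) * (2 * b + 8 * c * s ^ 2)
      = Lam * (2 * b * (lam / Lam * ((n : ℝ) - 1) + 1) + 8 * c * s ^ 2) := by
    field_simp
    ring
  have h2 : Lam * (2 * b * N + 8 * c * s ^ 2)
      ≤ Lam * (2 * b * (lam / Lam * ((n : ℝ) - 1) + 1) + 8 * c * s ^ 2) := by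
    refine mul_le_mul_of_nonneg_left ?_ hL.le
    nlinarith [mul_nonneg (neg_nonneg.mpr hb) (sub_nonneg.mpr hN)]
  linarith

section Comparison

open Filter Topology Set Real

variable {E : Type*} [NormedAddCommGroup E] {Lam N p : ℝ} {u : E → ℝ} {y : E}

/-- A twice differentiable radial function touching a `RadialSupersol` from below satisfies the
differential inequality. -/
lemma RadialSupersol.le_of_isLocalMin (hLam : 0 < Lam) (h : RadialSupersol Lam N p u y) {x₀ : E}
    {f f₁ : ℝ → ℝ} {f₂ : ℝ} (hf : ∀ᶠ s in 𝓝 (‖x₀ - y‖ ^ 2), HasDerivAt f (f₁ s) s)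
    (hf₁ : HasDerivAt f₁ f₂ (‖x₀ - y‖ ^ 2)) (hneg : f₁ (‖x₀ - y‖ ^ 2) ≤ 0)
    (hmin : IsLocalMin (fun x => u x - f (‖x - y‖ ^ 2)) x₀) :
    Lam * (4 * ‖x₀ - y‖ ^ 2 * f₂ + 2 * N * f₁ (‖x₀ - y‖ ^ 2)) + u x₀ ^ p ≤ 0 := by
  have hs0 : 0 ≤ ‖x₀ - y‖ ^ 2 := sq_nonneg _
  have hq : ContinuousAt (fun x => ‖x - y‖ ^ 2) x₀ := by fun_prop
  set s₀ := ‖x₀ - y‖ ^ 2 with hs₀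
  by_contra! hX
  set X := Lam * (4 * s₀ * f₂ + 2 * N * f₁ s₀) + u x₀ ^ p
  have hD : 0 < 16 * Lam * (s₀ + 1) := by positivity
  set δ := X / (16 * Lam * (s₀ + 1)) with hδ
  have hδ0 : 0 < δ := div_pos hX hD
  have hδX : δ * (16 * Lam * (s₀ + 1)) = X := div_mul_cancel₀ _ hD.ne'
  set c := f₂ / 2 - δ with hc
  have hψ : ∀ᶠ s in 𝓝 s₀, HasDerivAt (fun s => f s - (f₁ s₀ * s + c * (s - s₀) ^ 2))
      (f₁ s - (f₁ s₀ + 2 * c * (s - s₀))) s := by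
    filter_upwards [hf] with s hs
    refine (hs.sub (((hasDerivAt_id s).const_mul (f₁ s₀)).add
      ((((hasDerivAt_id s).sub_const s₀).pow 2).const_mul c))).congr_deriv ?_
    simp
    ring
  have hψ' : deriv (fun s => f s - (f₁ s₀ * s + c * (s - s₀) ^ 2)) =ᶠ[𝓝 s₀]
      fun s => f₁ s - (f₁ s₀ + 2 * c * (s - s₀)) := hψ.mono fun s hs => hs.deriv
  have hψ'' : HasDerivAt (fun s => f₁ s - (f₁ s₀ + 2 * c * (s - s₀))) (2 * δ) s₀ := by
    refine (hf₁.sub ((((hasDerivAt_id s₀).sub_const s₀).const_mul (2 * c)).const_add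
      (f₁ s₀))).congr_deriv ?_
    rw [hc]
    ring
  have hψmin : IsLocalMin (fun s => f s - (f₁ s₀ * s + c * (s - s₀) ^ 2)) s₀ := by
    refine isLocalMin_of_deriv_deriv_pos ?_ ?_ hψ.self_of_nhds.continuousAt
    · rw [hψ'.deriv_eq, hψ''.deriv]
      positivity
    · rw [hψ'.eq_of_nhds]
      ring
  have hcomp : IsLocalMin
      (fun x => f (‖x - y‖ ^ 2) - (f₁ s₀ * ‖x - y‖ ^ 2 + c * (‖x - y‖ ^ 2 - s₀) ^ 2)) x₀ :=
    hq.tendsto.eventually hψmin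
  have hsum := hmin.add hcomp
  simp only [sub_add_sub_cancel] at hsum
  have := h x₀ (f₁ s₀) c hneg hsum
  rw [← hs₀] at this
  nlinarith [mul_pos hLam hδ0]

variable [ProperSpace E]

/-- Comparison on the shell `a ≤ ‖x - y‖ ^ 2 ≤ b` (a ball if `a < 0`) with a strict radial
subsolution. -/
lemma RadialSupersol.comparison (hLam : 0 < Lam) (hu : Continuous u)
    (h : RadialSupersol Lam N p u y) {a b : ℝ} {f f₁ f₂ : ℝ → ℝ}
    (hf : ∀ s ∈ Icc a b, HasDerivAt f (f₁ s) s) (hf₁ : ∀ s ∈ Ioo a b, HasDerivAt f₁ (f₂ s) s)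
    (hneg : ∀ s ∈ Ioo a b, f₁ s ≤ 0)
    (hpos : ∀ x, ‖x - y‖ ^ 2 ∈ Ioo a b →
      0 < Lam * (4 * ‖x - y‖ ^ 2 * f₂ (‖x - y‖ ^ 2) + 2 * N * f₁ (‖x - y‖ ^ 2)) + u x ^ p)
    (ha : ∀ x, ‖x - y‖ ^ 2 = a → f a ≤ u x) (hb : ∀ x, ‖x - y‖ ^ 2 = b → f b ≤ u x) {x : E}
    (hx : ‖x - y‖ ^ 2 ∈ Icc a b) : f (‖x - y‖ ^ 2) ≤ u x := by
  have hq : Continuous (fun x => ‖x - y‖ ^ 2) := by fun_prop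
  have hK : IsCompact {x | ‖x - y‖ ^ 2 ∈ Icc a b} := by
    refine (isCompact_closedBall y (√b)).of_isClosed_subset (isClosed_Icc.preimage hq) ?_
    intro z hz
    rw [Metric.mem_closedBall, dist_eq_norm]
    exact Real.le_sqrt_of_sq_le hz.2
  have hcont : ContinuousOn (fun x => u x - f (‖x - y‖ ^ 2)) {x | ‖x - y‖ ^ 2 ∈ Icc a b} := by
    refine hu.continuousOn.sub ?_
    have hfc : ContinuousOn f (Icc a b) := fun s hs => (hf s hs).continuousAt.continuousWithinAt
    exact hfc.comp hq.continuousOn fun z hz => hz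
  obtain ⟨x₀, hx₀, hmin⟩ := hK.exists_isMinOn ⟨x, hx⟩ hcont
  have hle : u x₀ - f (‖x₀ - y‖ ^ 2) ≤ u x - f (‖x - y‖ ^ 2) := hmin hx
  suffices 0 ≤ u x₀ - f (‖x₀ - y‖ ^ 2) by linarith
  by_cases h1 : ‖x₀ - y‖ ^ 2 = a
  · rw [h1]
    exact sub_nonneg.mpr (ha x₀ h1)
  by_cases h2 : ‖x₀ - y‖ ^ 2 = b
  · rw [h2]
    exact sub_nonneg.mpr (hb x₀ h2)
  have hI : ‖x₀ - y‖ ^ 2 ∈ Ioo a b := ⟨lt_of_le_of_ne hx₀.1 (Ne.symm h1), lt_of_le_of_ne hx₀.2 h2⟩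
  have hnhds : {x | ‖x - y‖ ^ 2 ∈ Icc a b} ∈ 𝓝 x₀ :=
    hq.continuousAt.preimage_mem_nhds (Icc_mem_nhds hI.1 hI.2)
  have := h.le_of_isLocalMin hLam
    (eventually_of_mem (Icc_mem_nhds hI.1 hI.2) hf) (hf₁ _ hI) (hneg _ hI) (hmin.isLocalMin hnhds)
  exact absurd this (hpos x₀ hI).not_ge

/-- Comparison with the barriers `s ^ (-β) * (A + K * log (s / a)) - η`, where `s = ‖x - y‖ ^ 2`
and `2 * β` is the homogeneity of the fundamental solution. -/
lemma RadialSupersol.log_barrier (hLam : 0 < Lam) (hu : Continuous u) {β : ℝ}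
    (h : RadialSupersol Lam (2 * β + 2) p u y) {a b A K η : ℝ} (ha : 0 < a)
    (hg : ∀ s ∈ Ioo a b, K ≤ β * (A + K * (log s - log a)))
    (hpos : ∀ x, ‖x - y‖ ^ 2 ∈ Ioo a b →
      4 * β * Lam * K * (‖x - y‖ ^ 2) ^ (-β - 1) < u x ^ p)
    (hua : ∀ x, ‖x - y‖ ^ 2 = a → a ^ (-β) * A - η ≤ u x)
    (hub : ∀ x, ‖x - y‖ ^ 2 = b → b ^ (-β) * (A + K * (log b - log a)) - η ≤ u x) {x : E}
    (hx : ‖x - y‖ ^ 2 ∈ Icc a b) :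
    (‖x - y‖ ^ 2) ^ (-β) * (A + K * (log (‖x - y‖ ^ 2) - log a)) - η ≤ u x := by
  have hlog (s : ℝ) (hs : 0 < s) (A : ℝ) :
      HasDerivAt (fun s => A + K * (log s - log a)) (K * s⁻¹) s :=
    (((Real.hasDerivAt_log hs.ne').sub_const _).const_mul K).const_add A
  have hsub (s : ℝ) (hs : 0 < s) (γ : ℝ) : s ^ (γ - 1) = s ^ γ * s⁻¹ := by
    rw [Real.rpow_sub_one hs.ne', div_eq_mul_inv]
  have hf₁ (s : ℝ) (hs : s ∈ Ioo a b) : HasDerivAt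
      (fun s => s ^ (-β - 1) * (K - β * (A + K * (log s - log a))))
      (s ^ (-β - 1 - 1) * (-β * K - (β + 1) * (K - β * (A + K * (log s - log a))))) s := by
    have hs0 : 0 < s := ha.trans hs.1
    refine ((Real.hasDerivAt_rpow_const (Or.inl hs0.ne')).mul
      (((hlog s hs0 A).const_mul β).const_sub K)).congr_deriv ?_
    rw [hsub s hs0 (-β - 1)]
    ring
  refine h.comparison hLam hu
    (f := fun s => s ^ (-β) * (A + K * (log s - log a)) - η) ?_ hf₁ ?_ ?_ ?_ hub hx
  · intro s hs
    have hs0 : 0 < s := ha.trans_le hs.1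
    refine (((Real.hasDerivAt_rpow_const (Or.inl hs0.ne')).mul (hlog s hs0 A)).sub_const
      η).congr_deriv ?_
    rw [hsub s hs0 (-β)]
    ring
  · intro s hs
    exact mul_nonpos_of_nonneg_of_nonpos (Real.rpow_nonneg (ha.trans hs.1).le _)
      (sub_nonpos.mpr (hg s hs))
  · intro z hz
    have hs0 : 0 < ‖z - y‖ ^ 2 := ha.trans hz.1
    have := hpos z hz
    rw [hsub _ hs0 (-β - 1)]
    have hinv : ‖z - y‖ ^ 2 * (‖z - y‖ ^ 2)⁻¹ = 1 := mul_inv_cancel₀ hs0.ne'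
    generalize ‖z - y‖ ^ 2 = s at *
    generalize s ^ (-β - 1) = r at *
    generalize A + K * (log s - log a) = g at *
    have : Lam * (4 * s * (r * s⁻¹ * (-β * K - (β + 1) * (K - β * g)))
        + 2 * (2 * β + 2) * (r * (K - β * g))) = -(4 * β * Lam * K * r) := by
      linear_combination (Lam * 4 * r * (-β * K - (β + 1) * (K - β * g))) * hinv
    linarith
  · intro z hz
    simpa using hua z hz

/-- Hadamard type lower bound: decay no faster than the fundamental solution. -/
lemma RadialSupersol.fundamental_le (hLam : 0 < Lam) (hu : Continuous u) (hu0 : ∀ x, 0 ≤ u x)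
    {β : ℝ} (hβ : 0 < β) (h : RadialSupersol Lam (2 * β + 2) p u y) {a A : ℝ} (ha : 0 < a)
    (hua : ∀ x, ‖x - y‖ ^ 2 = a → a ^ (-β) * A ≤ u x) {x : E} (hx : a ≤ ‖x - y‖ ^ 2) :
    (‖x - y‖ ^ 2) ^ (-β) * A ≤ u x := by
  have hx0 : 0 < ‖x - y‖ ^ 2 := ha.trans_le hx
  have hr : 0 < (‖x - y‖ ^ 2) ^ (-β) := Real.rpow_pos_of_pos hx0 _
  have hε (ε : ℝ) (hε : 0 < ε) :
      (‖x - y‖ ^ 2) ^ (-β) * (A + -ε * (log (‖x - y‖ ^ 2) - log a)) ≤ u x := by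
    set b := a * exp (A / ε) with hb
    have hlb : log b - log a = A / ε := by
      rw [hb, Real.log_mul ha.ne' (exp_pos _).ne', Real.log_exp]
      ring
    have hzero : A + -ε * (log b - log a) = 0 := by
      rw [hlb]
      field_simp
      ring
    have hb0 : 0 < b := by positivity
    rcases le_or_gt (‖x - y‖ ^ 2) b with hxb | hxb
    · have := h.log_barrier hLam hu (b := b) (A := A) (K := -ε) (η := 0) ha ?_ ?_ ?_ ?_ ⟨hx, hxb⟩
      · simpa using this
      · intro s hs
        have : log s ≤ log b := Real.log_le_log (ha.trans hs.1) hs.2.le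
        have : 0 ≤ A + -ε * (log s - log a) := by nlinarith
        nlinarith [mul_nonneg hβ.le this]
      · intro z hz
        have h1 : 0 < (‖z - y‖ ^ 2) ^ (-β - 1) := Real.rpow_pos_of_pos (ha.trans hz.1) _
        have h2 : 0 < 4 * β * Lam * ε * (‖z - y‖ ^ 2) ^ (-β - 1) := by positivity
        have h3 : 0 ≤ u z ^ p := Real.rpow_nonneg (hu0 z) p
        linarith
      · simpa using hua
      · intro z _
        rw [hzero]
        simpa using hu0 z
    · refine le_trans (mul_nonpos_of_nonneg_of_nonpos hr.le ?_) (hu0 x)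
      have := Real.log_le_log hb0 hxb.le
      nlinarith
  have hlim : Tendsto (fun ε : ℝ => (‖x - y‖ ^ 2) ^ (-β) * (A + -ε * (log (‖x - y‖ ^ 2) - log a)))
      (𝓝[>] 0) (𝓝 ((‖x - y‖ ^ 2) ^ (-β) * (A + -0 * (log (‖x - y‖ ^ 2) - log a)))) :=
    (Continuous.tendsto (by fun_prop) 0).mono_left nhdsWithin_le_nhds
  have := le_of_tendsto hlim (eventually_of_mem self_mem_nhdsWithin fun ε h => hε ε h)
  simpa using this

/-- At the critical exponent the lower bound improves by a logarithm. -/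
lemma RadialSupersol.log_le (hLam : 0 < Lam) (hu : Continuous u) (hu0 : ∀ x, 0 ≤ u x)
    {β : ℝ} (hβ : 0 < β) (hp : 0 < p) (hβp : β * p = β + 1)
    (h : RadialSupersol Lam (2 * β + 2) p u y)
    {a A K : ℝ} (ha : 0 < a) (hA : 0 < A) (hK0 : 0 ≤ K) (hKA : K ≤ β * A)
    (hKp : 4 * β * Lam * K < A ^ p) (hua : ∀ x, ‖x - y‖ ^ 2 = a → a ^ (-β) * A ≤ u x) {x : E}
    (hx : a ≤ ‖x - y‖ ^ 2) :
    (‖x - y‖ ^ 2) ^ (-β) * (A + K * (log (‖x - y‖ ^ 2) - log a)) ≤ u x := by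
  refine le_of_forall_pos_le_add fun η hη => ?_
  have hlim : Tendsto (fun b : ℝ => b ^ (-β) * (A + K * (log b - log a))) atTop (𝓝 0) := by
    have h1 := tendsto_rpow_neg_atTop hβ
    have h2 : Tendsto (fun b : ℝ => log b / b ^ β) atTop (𝓝 0) :=
      (isLittleO_log_rpow_atTop hβ).tendsto_div_nhds_zero
    have h3 := (h1.mul_const (A - K * log a)).add (h2.const_mul K)
    simp only [zero_mul, mul_zero, add_zero] at h3
    refine h3.congr' ?_
    filter_upwards [eventually_gt_atTop 0] with b hb
    rw [Real.rpow_neg hb.le]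
    ring
  obtain ⟨b, hbη, hxb⟩ :=
    ((hlim.eventually_lt_const hη).and (eventually_ge_atTop (‖x - y‖ ^ 2))).exists
  rw [← sub_le_iff_le_add]
  refine h.log_barrier hLam hu (b := b) ha ?_ ?_ ?_ ?_ ⟨hx, hxb⟩
  · intro s hs
    have := Real.log_le_log ha hs.1.le
    nlinarith [mul_nonneg hβ.le (mul_nonneg hK0 (sub_nonneg.mpr this))]
  · intro z hz
    have hs0 : 0 < ‖z - y‖ ^ 2 := ha.trans hz.1
    have h1 := h.fundamental_le hLam hu hu0 hβ ha hua hz.1.le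
    have hr : 0 < (‖z - y‖ ^ 2) ^ (-β - 1) := Real.rpow_pos_of_pos hs0 _
    have h2 : ((‖z - y‖ ^ 2) ^ (-β) * A) ^ p = (‖z - y‖ ^ 2) ^ (-β - 1) * A ^ p := by
      rw [Real.mul_rpow (Real.rpow_nonneg hs0.le _) hA.le, ← Real.rpow_mul hs0.le]
      congr 2
      linarith
    calc 4 * β * Lam * K * (‖z - y‖ ^ 2) ^ (-β - 1)
        < A ^ p * (‖z - y‖ ^ 2) ^ (-β - 1) := mul_lt_mul_of_pos_right hKp hr
      _ = ((‖z - y‖ ^ 2) ^ (-β) * A) ^ p := by rw [h2, mul_comm]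
      _ ≤ u z ^ p := Real.rpow_le_rpow (by positivity) h1 hp.le
  · intro z hz
    linarith [hua z hz]
  · intro z _
    linarith [hu0 z]

lemma rpow_neg_mul_add_log_le {β a b q A K : ℝ} (hβ : 0 < β) (ha : 0 < a) (haq : a ≤ q)
    (hqb : q ≤ b) (hA : 0 ≤ A) (hK0 : 0 ≤ K) (hKA : K ≤ β * A) :
    b ^ (-β) * (A + K * (log b - log a)) ≤ q ^ (-β) * (A + K * (log q - log a)) := by
  have hq : 0 < q := ha.trans_le haq
  have hb : 0 < b := hq.trans_le hqb
  have hbβ : 0 < b ^ β := Real.rpow_pos_of_pos hb _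
  have hqβ : 0 < q ^ β := Real.rpow_pos_of_pos hq _
  have h1 : β * (log b - log q) ≤ b ^ β / q ^ β - 1 := by
    have := Real.log_le_sub_one_of_pos (div_pos hbβ hqβ)
    rwa [Real.log_div hbβ.ne' hqβ.ne', Real.log_rpow hb, Real.log_rpow hq, ← mul_sub] at this
  have hlq : 0 ≤ log q - log a := sub_nonneg.mpr (Real.log_le_log ha haq)
  have hlb : 0 ≤ log b - log q := sub_nonneg.mpr (Real.log_le_log hq hqb)
  have hd : 0 ≤ b ^ β / q ^ β - 1 := (mul_nonneg hβ.le hlb).trans h1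
  have h2 : A + K * (log b - log a) ≤ (A + K * (log q - log a)) * (b ^ β / q ^ β) := by
    have e1 : K * (log b - log q) ≤ A * (b ^ β / q ^ β - 1) := by
      nlinarith [mul_le_mul_of_nonneg_right hKA hlb, mul_le_mul_of_nonneg_left h1 hA]
    nlinarith [mul_nonneg (mul_nonneg hK0 hlq) hd]
  rw [Real.rpow_neg hb.le, Real.rpow_neg hq.le, inv_mul_le_iff₀ hbβ]
  refine h2.trans (le_of_eq ?_)
  field_simp

/-- Universal upper bound for the minimum over a ball. -/
lemma RadialSupersol.exists_min_bound (hLam : 0 < Lam) (hu : Continuous u) (hu0 : ∀ x, 0 ≤ u x)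
    {β : ℝ} (hβ : 0 < β) (hp : 1 < p) (hβp : β * p = β + 1)
    (h : RadialSupersol Lam (2 * β + 2) p u y) :
    ∃ C, ∀ b c : ℝ, 0 < b → 0 < c → (∀ x, ‖x - y‖ ^ 2 ≤ b → c ≤ u x) → b ^ β * c ≤ C := by
  set D : ℝ := 3 * ((4 : ℝ) ^ (-β)) ^ p / (8 * Lam * (β + 1)) with hD
  have hD0 : 0 < D := by positivity
  refine ⟨(D⁻¹) ^ β, fun b c hb hc hbc => ?_⟩
  obtain ⟨x₀, hx₀, hmin⟩ := (isCompact_closedBall y (√b)).exists_isMinOn ⟨y, by simp⟩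
    hu.continuousOn
  have hball (x : E) : x ∈ Metric.closedBall y (√b) ↔ ‖x - y‖ ^ 2 ≤ b := by
    rw [Metric.mem_closedBall, dist_eq_norm, Real.le_sqrt (norm_nonneg _) hb.le]
  rw [hball] at hx₀
  replace hmin (x : E) (hx : ‖x - y‖ ^ 2 ≤ b) : u x₀ ≤ u x := hmin ((hball x).mpr hx)
  have hcm : c ≤ u x₀ := hbc x₀ hx₀
  have hm : 0 < u x₀ := hc.trans_le hcm
  set m := u x₀
  have h4 : (4 : ℝ) ^ (-β) ≤ 1 := Real.rpow_le_one_of_one_le_of_nonpos (by norm_num) (by linarith)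
  have hbig (x : E) (hx : ‖x - y‖ ^ 2 ≤ 4 * b) : (4 : ℝ) ^ (-β) * m ≤ u x := by
    rcases le_total (‖x - y‖ ^ 2) b with hxb | hxb
    · exact (mul_le_of_le_one_left hm.le h4).trans (hmin x hxb)
    · have hbb : b ^ (-β) * b ^ β = 1 := by
        rw [← Real.rpow_add hb]
        simp
      have h1 := h.fundamental_le hLam hu hu0 hβ hb (A := b ^ β * m)
        (fun z hz => by rw [← mul_assoc, hbb, one_mul]; exact hmin z hz.le) hxb
      have h2 : (4 * b) ^ (-β) ≤ (‖x - y‖ ^ 2) ^ (-β) :=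
        Real.rpow_le_rpow_of_nonpos (hb.trans_le hxb) hx (by linarith)
      calc (4 : ℝ) ^ (-β) * m = (4 * b) ^ (-β) * (b ^ β * m) := by
            rw [Real.mul_rpow (by norm_num) hb.le]
            linear_combination (-(4 : ℝ) ^ (-β) * m) * hbb
        _ ≤ (‖x - y‖ ^ 2) ^ (-β) * (b ^ β * m) := by gcongr
        _ ≤ u x := h1
  set M := (4 : ℝ) ^ (-β) * m with hM
  have hM0 : 0 < M := by positivity
  set k := M ^ p / (8 * Lam * (β + 1)) with hk
  have hk0 : 0 < k := by positivity
  have hkM : 8 * Lam * (β + 1) * k = M ^ p := by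
    rw [hk]
    field_simp
  have hpar : M + k * (4 * b - ‖x₀ - y‖ ^ 2) ≤ m := by
    refine h.comparison hLam hu (a := -1) (b := 4 * b) (f := fun s => M + k * (4 * b - s))
      (f₁ := fun _ => -k) (f₂ := fun _ => 0) ?_ ?_ ?_ ?_ ?_ ?_ ?_
    · intro s _
      refine ((((hasDerivAt_id s).const_sub (4 * b)).const_mul k).const_add M).congr_deriv ?_
      ring
    · exact fun s _ => hasDerivAt_const s (-k)
    · exact fun s _ => by linarith
    · intro x hx
      have h1 : M ^ p ≤ u x ^ p :=
        Real.rpow_le_rpow hM0.le (hbig x hx.2.le) (zero_lt_one.trans hp).le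
      have h2 : 0 < Lam * (β + 1) * k := by positivity
      nlinarith
    · intro x hx
      nlinarith [sq_nonneg ‖x - y‖]
    · intro x hx
      simpa using hbig x hx.le
    · exact ⟨by nlinarith [sq_nonneg ‖x₀ - y‖], by linarith⟩
  have h3 : 3 * k * b ≤ m := by nlinarith
  have h4 : 3 * k = D * (m * m ^ (p - 1)) := by
    rw [hk, hD, hM, Real.mul_rpow (by positivity) hm.le, ← Real.rpow_one_add' hm.le (by linarith)]
    ring_nf
  have h5 : b * m ^ (p - 1) ≤ D⁻¹ := by
    rw [← one_div, le_div_iff₀ hD0]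
    rw [h4] at h3
    refine le_of_mul_le_mul_left ?_ hm
    linarith
  have h6 : (m ^ (p - 1)) ^ β = m := by
    rw [← Real.rpow_mul hm.le, show (p - 1) * β = 1 by linarith, Real.rpow_one]
  calc b ^ β * c ≤ b ^ β * m := by gcongr
    _ = (b * m ^ (p - 1)) ^ β := by rw [Real.mul_rpow hb.le (by positivity), h6]
    _ ≤ D⁻¹ ^ β := Real.rpow_le_rpow (by positivity) h5 hβ.le

/-- Liouville property at the critical exponent. -/
lemma RadialSupersol.eq_zero (hLam : 0 < Lam) (hu : Continuous u) (hu0 : ∀ x, 0 ≤ u x)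
    {β : ℝ} (hβ : 0 < β) (hp : 1 < p) (hβp : β * p = β + 1)
    (h : RadialSupersol Lam (2 * β + 2) p u y) : u y = 0 := by
  by_contra hne
  have hpos : 0 < u y := lt_of_le_of_ne (hu0 y) (Ne.symm hne)
  obtain ⟨r, hr, hball⟩ := Metric.eventually_nhds_iff_ball.mp
    (hu.continuousAt.eventually_const_lt (half_lt_self hpos))
  set c := u y / 2
  have hc : 0 < c := half_pos hpos
  set a := (r / 2) ^ 2 with ha_def
  have ha : 0 < a := by positivity
  have hca (x : E) (hx : ‖x - y‖ ^ 2 ≤ a) : c ≤ u x := by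
    refine (hball x ?_).le
    rw [Metric.mem_ball, dist_eq_norm]
    linarith [(sq_le_sq₀ (norm_nonneg _) (by positivity)).mp hx]
  have haa : a ^ (-β) * a ^ β = 1 := by
    rw [← Real.rpow_add ha]
    simp
  set A := a ^ β * c with hA_def
  have hA : 0 < A := by positivity
  have hAc : a ^ (-β) * A = c := by rw [hA_def, ← mul_assoc, haa, one_mul]
  set K := min (β * A) (A ^ p / (8 * β * Lam)) with hK_def
  have hK : 0 < K := by positivity
  have hKp : 4 * β * Lam * K < A ^ p := by
    have h1 : K ≤ A ^ p / (8 * β * Lam) := min_le_right _ _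
    rw [le_div_iff₀ (by positivity)] at h1
    have h2 : 0 < β * Lam * K := by positivity
    linarith
  obtain ⟨C, hC⟩ := h.exists_min_bound hLam hu hu0 hβ hp hβp
  set b := a * exp (|C| / K) with hb_def
  have hab : a ≤ b := le_mul_of_one_le_right ha.le (Real.one_le_exp (by positivity))
  have hb : 0 < b := ha.trans_le hab
  have hlog : log b - log a = |C| / K := by
    rw [hb_def, Real.log_mul ha.ne' (exp_pos _).ne', Real.log_exp]
    ring
  have hval : A + K * (log b - log a) = A + |C| := by
    rw [hlog]
    field_simp
  have hbb : b ^ β * b ^ (-β) = 1 := by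
    rw [← Real.rpow_add hb]
    simp
  have := hC b (b ^ (-β) * (A + K * (log b - log a))) hb
    (by rw [hval]; positivity) fun x hx => ?_
  · rw [← mul_assoc, hbb, one_mul, hval] at this
    linarith [le_abs_self C]
  · rcases le_total (‖x - y‖ ^ 2) a with hxa | hxa
    · have := rpow_neg_mul_add_log_le hβ ha le_rfl hab hA.le hK.le (min_le_left _ _)
      rw [sub_self, mul_zero, add_zero, hAc] at this
      exact this.trans (hca x hxa)
    · exact (rpow_neg_mul_add_log_le hβ ha hxa hx hA.le hK.le (min_le_left _ _)).trans
        (h.log_le hLam hu hu0 hβ (zero_lt_one.trans hp) hβp ha hA hK.le (min_le_left _ _) hKp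
          (fun z hz => by rw [hAc]; exact hca z hz.le) hxa)

end Comparison

theorem stmt0 (n : ℕ) (hn : 3 ≤ n) (lam Lam : ℝ) (hlam : 0 < lam) (hLam : lam ≤ Lam)
    (nt : ℝ) (hnt : nt = lam / Lam * ((n : ℝ) - 1) + 1)
    (p : ℝ) (hp : 1 < p)
    (hcrit : (2 < nt ∧ p ≤ nt / (nt - 2)) ∨ nt ≤ 2)
    (u : EuclideanSpace ℝ (Fin n) → ℝ) (hu : Continuous u) (hnonneg : ∀ x, 0 ≤ u x)
    (hsuper : PucciSupersol lam Lam Set.univ u (fun x => u x ^ p)) :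
    ∀ x, u x = 0 := by
  have hp0 : 0 < p - 1 := sub_pos.mpr hp
  have hβ : 0 < 1 / (p - 1) := one_div_pos.mpr hp0
  have hN : lam / Lam * ((n : ℝ) - 1) + 1 ≤ 2 * (1 / (p - 1)) + 2 := by
    rw [← hnt]
    rcases hcrit with ⟨h2, hle⟩ | h2
    · rw [le_div_iff₀ (sub_pos.mpr h2)] at hle
      rw [← sub_le_iff_le_add, mul_one_div, le_div_iff₀ hp0]
      linarith
    · linarith
  intro y
  refine (hsuper.radialSupersol (by omega) hlam hLam hN y).eq_zero (hlam.trans_le hLam) hu hnonneg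
    hβ hp ?_
  field_simp
  ring
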